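/- Let n ≥ 2, Ω ⊂ ℝⁿ bounded with T₀ := diam(Ω) > 0, let f ≥ 0 be an integrable function on ℝⁿ vanishing outside Ω, and let p > 1, q > 0, 0 < s < ∞, θ > 1 be constants with m := q(θ−1)/(θ(p−1)) > 1 and κ := q(θ−1)/(p−1) ∈ (0, n]. Fix x₀ ∈ ℝⁿ and 0 < ρ < T₀, write B := B_{10ρ}(x₀), and set N := sup_{x' ∈ Ω, 0 < ρ' < T₀} ρ'^{(κ−n)/m} ‖f‖_{L^{m, s(θ−1)/(θ(p−1))}(B_{ρ'}(x') ∩ Ω)}. Assume the pointwise Hedberg-type estimate 𝐌₁(χ_B f)(x) ≤ C₀·[𝐌(χ_B f)(x)]^{(θ−1)/θ}·N^{1/θ} holds for every x ∈ B, with a constant C₀ > 0. Then there exists a constant C depending only on n, p, q, s, θ, C₀ such that ρ^{−n(p−1)/q + θ − 1} · ‖𝐌₁(χ_B f)‖_{L^{q/(p−1), s/(p−1)}(B_ρ(x₀))} ≤ C · N. -/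

import Mathlib

open MeasureTheory Metric Set
open scoped ENNReal

/-- The Lorentz quasinorm `‖g‖_{L^{a,b}(D)}` of a nonnegative (extended-real
valued) function `g` on `D ⊆ ℝⁿ`:
`( a ∫₀^∞ t^{b-1} ℒⁿ({x ∈ D : g(x) > t})^{b/a} dt )^{1/b}`. -/
noncomputable def paperLorentzNorm {n : ℕ} (a b : ℝ)
    (D : Set (EuclideanSpace ℝ (Fin n))) (g : EuclideanSpace ℝ (Fin n) → ℝ≥0∞) :
    ℝ≥0∞ :=
  (ENNReal.ofReal a *
      ∫⁻ t in Ioi (0 : ℝ),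
        ENNReal.ofReal (t ^ (b - 1)) *
          (volume {x ∈ D | ENNReal.ofReal t < g x}) ^ (b / a)) ^ (1 / b)

/-- The centered Hardy–Littlewood maximal function
`𝐌(g)(z) = sup_{r>0} (1/ℒⁿ(B_r(z))) ∫_{B_r(z)} g`. -/
noncomputable def paperHLMax {n : ℕ} (g : EuclideanSpace ℝ (Fin n) → ℝ≥0∞)
    (z : EuclideanSpace ℝ (Fin n)) : ℝ≥0∞ :=
  ⨆ (r : ℝ) (_ : 0 < r), (volume (ball z r))⁻¹ * ∫⁻ y in ball z r, g y

/-- The fractional maximal function of order 1: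
`𝐌₁(g)(z) = sup_{r>0} r^{1-n} ∫_{B_r(z)} g`. -/
noncomputable def paperFracMax1 {n : ℕ} (g : EuclideanSpace ℝ (Fin n) → ℝ≥0∞)
    (z : EuclideanSpace ℝ (Fin n)) : ℝ≥0∞ :=
  ⨆ (r : ℝ) (_ : 0 < r),
    ENNReal.ofReal (r ^ (1 - (n : ℝ))) * ∫⁻ y in ball z r, g y

/-- The Lorentz–Morrey norm
`N = sup_{x'∈Ω, 0<ρ'<T₀} ρ'^{(κ-n)/m} ‖g‖_{L^{m,b}(B_{ρ'}(x')∩Ω)}`. -/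
noncomputable def paperLorentzMorrey {n : ℕ} (m b κ T₀ : ℝ)
    (Ω : Set (EuclideanSpace ℝ (Fin n))) (g : EuclideanSpace ℝ (Fin n) → ℝ≥0∞) :
    ℝ≥0∞ :=
  ⨆ (x' : EuclideanSpace ℝ (Fin n)) (_ : x' ∈ Ω)
    (ρ' : ℝ) (_ : 0 < ρ') (_ : ρ' < T₀),
    ENNReal.ofReal (ρ' ^ ((κ - n) / m)) * paperLorentzNorm m b (ball x' ρ' ∩ Ω) g

/-- weak type -/
lemma weakType {n : ℕ} (hn : 2 ≤ n) (g : EuclideanSpace ℝ (Fin n) → ℝ≥0∞)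
    (hg : ∫⁻ y, g y ≠ ⊤) (t : ℝ) (ht : 0 < t) :
    volume {x | ENNReal.ofReal t < paperHLMax g x} ≤
      ENNReal.ofReal (5 ^ n / t) * ∫⁻ y, g y := by
  classical
  have : Nonempty (Fin n) := ⟨⟨0, by omega⟩⟩
  have : Nontrivial (EuclideanSpace ℝ (Fin n)) := by
    apply Module.nontrivial_of_finrank_pos (R := ℝ)
    simp; omega
  set E := {x | ENNReal.ofReal t < paperHLMax g x} with hE
  have h1 : ∀ x ∈ E, ∃ r : ℝ, 0 < r ∧
      ENNReal.ofReal t * volume (ball x r) ≤ ∫⁻ y in ball x r, g y := by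
    intro x hx
    simp only [hE, mem_ofPred_eq, paperHLMax, lt_iSup_iff] at hx
    obtain ⟨r, hr, h⟩ := hx
    refine ⟨r, hr, ?_⟩
    have hv : volume (ball x r) ≠ 0 := (measure_ball_pos volume x hr).ne'
    have hv' : volume (ball x r) ≠ ⊤ := measure_ball_lt_top.ne
    calc ENNReal.ofReal t * volume (ball x r)
        ≤ ((volume (ball x r))⁻¹ * ∫⁻ y in ball x r, g y) * volume (ball x r) := by gcongr
      _ = ((volume (ball x r))⁻¹ * volume (ball x r)) * ∫⁻ y in ball x r, g y := by ring
      _ = _ := by rw [ENNReal.inv_mul_cancel hv hv', one_mul]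
  choose! R hR0 hR using h1
  have hfin : Module.finrank ℝ (EuclideanSpace ℝ (Fin n)) = n := by simp
  -- bound on the radii
  set v := volume (ball (0 : EuclideanSpace ℝ (Fin n)) 1) with hv
  have hv0 : v ≠ 0 := (measure_ball_pos volume _ one_pos).ne'
  have hvt : v ≠ ⊤ := measure_ball_lt_top.ne
  have hball : ∀ (x : EuclideanSpace ℝ (Fin n)) (r : ℝ), 0 ≤ r →
      volume (ball x r) = ENNReal.ofReal (r ^ n) * v := by
    intro x r hr
    rw [Measure.addHaar_ball _ _ hr, hfin]
  have hcball : ∀ (x : EuclideanSpace ℝ (Fin n)) (r : ℝ), 0 ≤ r →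
      volume (closedBall x r) = ENNReal.ofReal (r ^ n) * v := by
    intro x r hr
    rw [Measure.addHaar_closedBall _ _ hr, hfin]
  obtain ⟨Q, hQ⟩ : ∃ Q : ℝ, ∀ x ∈ E, R x ≤ Q := by
    set W := (∫⁻ y, g y) / (ENNReal.ofReal t * v) with hW
    have hd0 : ENNReal.ofReal t * v ≠ 0 := mul_ne_zero (by simpa using ht) hv0
    have hdt : ENNReal.ofReal t * v ≠ ⊤ := ENNReal.mul_ne_top (by simp) hvt
    have hWt : W ≠ ⊤ := ENNReal.div_ne_top hg hd0
    refine ⟨max 1 W.toReal, fun x hx => ?_⟩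
    by_contra! hlt
    have h1 : 1 < R x := lt_of_le_of_lt (le_max_left _ _) hlt
    have h2 : W.toReal < R x := lt_of_le_of_lt (le_max_right _ _) hlt
    have h3 : ENNReal.ofReal (R x ^ n) ≤ W := by
      rw [hW, ENNReal.le_div_iff_mul_le (Or.inl hd0) (Or.inl hdt)]
      calc ENNReal.ofReal (R x ^ n) * (ENNReal.ofReal t * v)
          = ENNReal.ofReal t * (ENNReal.ofReal (R x ^ n) * v) := by ring
        _ = ENNReal.ofReal t * volume (ball x (R x)) := by rw [hball _ _ (hR0 x hx).le]
        _ ≤ _ := hR x hx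
        _ ≤ _ := setLIntegral_le_lintegral _ _
    have h4 := ENNReal.toReal_mono hWt h3
    rw [ENNReal.toReal_ofReal (by positivity)] at h4
    have h5 : R x ≤ R x ^ n := le_self_pow₀ h1.le (by omega)
    linarith
  obtain ⟨u, huE, hdisj, hcov⟩ :=
    Vitali.exists_disjoint_subfamily_covering_enlargement_closedBall E (fun x => x) R Q hQ
      5 (by norm_num)
  have hdisjb : u.PairwiseDisjoint (fun a => ball a (R a)) :=
    hdisj.mono (fun a => ball_subset_closedBall)
  have hcount : u.Countable := by
    refine hdisjb.countable_of_isOpen (fun _ _ => isOpen_ball) ?_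
    intro a ha
    exact ⟨a, mem_ball_self (hR0 a (huE ha))⟩
  have hsub : E ⊆ ⋃ a ∈ u, closedBall a (5 * R a) := by
    intro x hx
    obtain ⟨b, hb, hxb⟩ := hcov x hx
    exact mem_iUnion₂.2 ⟨b, hb, hxb (mem_closedBall_self (hR0 x hx).le)⟩
  calc volume E ≤ volume (⋃ a ∈ u, closedBall a (5 * R a)) := measure_mono hsub
    _ ≤ ∑' a : u, volume (closedBall (a : EuclideanSpace ℝ (Fin n)) (5 * R a)) :=
        measure_biUnion_le _ hcount _
    _ ≤ ∑' a : u, ENNReal.ofReal (5 ^ n / t) * ∫⁻ y in ball (a : EuclideanSpace ℝ (Fin n)) (R a), g y := by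
        refine ENNReal.tsum_le_tsum fun a => ?_
        have ha := huE a.2
        have hr := (hR0 a ha).le
        calc volume (closedBall (a : EuclideanSpace ℝ (Fin n)) (5 * R a))
            = ENNReal.ofReal (5 ^ n / t) * (ENNReal.ofReal t * volume (ball (a : EuclideanSpace ℝ (Fin n)) (R a))) := by
              rw [hcball _ _ (by positivity), hball _ _ hr, ← mul_assoc, ← mul_assoc,
                ← ENNReal.ofReal_mul (by positivity), ← ENNReal.ofReal_mul (by positivity)]
              congr 2
              rw [mul_pow]
              field_simp
          _ ≤ _ := by gcongr; exact hR a ha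
    _ = ENNReal.ofReal (5 ^ n / t) * ∫⁻ y in ⋃ a ∈ u, ball a (R a), g y := by
        rw [ENNReal.tsum_mul_left, lintegral_biUnion hcount (fun _ _ => measurableSet_ball) hdisjb]
    _ ≤ _ := by gcongr; exact Measure.restrict_le_self

/-- substitution -/
lemma substIoi (c α b : ℝ) (hc : 0 < c) (hα : 0 < α) (φ : ℝ → ℝ≥0∞) :
    ∫⁻ u in Ioi (0 : ℝ), ENNReal.ofReal (u ^ (b - 1)) * φ u =
      ENNReal.ofReal (c ^ b * α) *
        ∫⁻ t in Ioi (0 : ℝ), ENNReal.ofReal (t ^ (α * b - 1)) * φ (c * t ^ α) := by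
  have himg : (fun t : ℝ => c * t ^ α) '' Ioi 0 = Ioi 0 := by
    ext u
    constructor
    · rintro ⟨t, ht, rfl⟩
      have : (0 : ℝ) < t := ht
      exact mem_Ioi.2 (by positivity)
    · intro hu
      have hu : (0 : ℝ) < u := hu
      refine ⟨(u / c) ^ (α⁻¹), mem_Ioi.2 (by positivity), ?_⟩
      simp only
      rw [← Real.rpow_mul (by positivity), inv_mul_cancel₀ hα.ne', Real.rpow_one]
      field_simp
  have hinj : InjOn (fun t : ℝ => c * t ^ α) (Ioi 0) := by
    intro x hx y hy hxy
    have hx : (0 : ℝ) < x := hx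
    have hy : (0 : ℝ) < y := hy
    have := mul_left_cancel₀ hc.ne' hxy
    exact (Real.rpow_left_inj hx.le hy.le hα.ne').1 this
  have hder : ∀ x ∈ Ioi (0 : ℝ), HasDerivWithinAt (fun t : ℝ => c * t ^ α)
      (c * (α * x ^ (α - 1))) (Ioi 0) x := by
    intro x hx
    have hx : (0 : ℝ) < x := hx
    exact ((Real.hasDerivAt_rpow_const (Or.inl hx.ne')).const_mul c).hasDerivWithinAt
  have key := lintegral_image_eq_lintegral_abs_deriv_mul measurableSet_Ioi hder hinj
    (fun u => ENNReal.ofReal (u ^ (b - 1)) * φ u)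
  rw [himg] at key
  rw [key, ← lintegral_const_mul' _ _ ENNReal.ofReal_ne_top]
  refine setLIntegral_congr_fun measurableSet_Ioi ?_
  intro t ht
  have ht : (0 : ℝ) < t := ht
  simp only
  rw [abs_of_pos (by positivity), ← mul_assoc, ← mul_assoc (ENNReal.ofReal (c ^ b * α)),
    ← ENNReal.ofReal_mul (by positivity), ← ENNReal.ofReal_mul (by positivity)]
  congr 2
  rw [Real.mul_rpow hc.le (by positivity), ← Real.rpow_mul ht.le]
  have e1 : c ^ b = c * c ^ (b - 1) := by
    rw [Real.rpow_sub_one hc.ne']; field_simp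
  have e2 : t ^ (α * b - 1) = t ^ (α - 1) * t ^ (α * (b - 1)) := by
    rw [← Real.rpow_add ht]; congr 1; ring
  rw [e1, e2]; ring

lemma lint_meas (b r : ℝ) {X : Type*} [MeasurableSpace X] (μ : Measure X)
    (D : Set X) (g : X → ℝ≥0∞) :
    Measurable (fun t : ℝ => ENNReal.ofReal (t ^ (b - 1)) *
      (μ {x ∈ D | ENNReal.ofReal t < g x}) ^ r) := by
  have : Antitone (fun t : ℝ => μ {x ∈ D | ENNReal.ofReal t < g x}) := by
    intro t t' h
    refine measure_mono ?_
    rintro x ⟨hx, hx'⟩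
    exact ⟨hx, lt_of_le_of_lt (ENNReal.ofReal_le_ofReal h) hx'⟩
  have h1 : Measurable (fun t : ℝ => ENNReal.ofReal (t ^ (b - 1))) := by fun_prop
  exact h1.mul (this.measurable.pow_const r)

lemma levelBound {n : ℕ} (hn : 2 ≤ n) (F : EuclideanSpace ℝ (Fin n) → ℝ≥0∞)
    (hF : AEMeasurable F) (hFt : ∀ x, F x ≠ ⊤) (hI : ∫⁻ y, F y ≠ ⊤) (t : ℝ) (ht : 0 < t) :
    volume {x | ENNReal.ofReal t < paperHLMax F x} ≤
      ENNReal.ofReal (2 * 5 ^ n) *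
        ∑' i : ℕ, ENNReal.ofReal (2 ^ i) *
          volume {x | ENNReal.ofReal (2 ^ i / 2 * t) < F x} := by
  classical
  set S := {x | ENNReal.ofReal (t / 2) < F x} with hS
  set g := S.indicator F with hg
  have hgle : ∀ x, g x ≤ F x := fun x => indicator_le_self _ _ x
  have hgI : ∫⁻ y, g y ≠ ⊤ := ne_top_of_le_ne_top hI (lintegral_mono hgle)
  have hM : ∀ x, paperHLMax F x ≤ paperHLMax g x + ENNReal.ofReal (t / 2) := by
    intro x
    unfold paperHLMax
    refine iSup₂_le fun r hr => ?_
    have hv : volume (ball x r) ≠ 0 := (measure_ball_pos volume x hr).ne'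
    have hv' : volume (ball x r) ≠ ⊤ := measure_ball_lt_top.ne
    calc (volume (ball x r))⁻¹ * ∫⁻ y in ball x r, F y
        ≤ (volume (ball x r))⁻¹ * ∫⁻ y in ball x r, (g y + ENNReal.ofReal (t / 2)) := by
          gcongr with y
          by_cases hy : y ∈ S
          · rw [hg, indicator_of_mem hy]; exact le_self_add
          · rw [hg, indicator_of_notMem hy, zero_add]
            exact not_lt.1 hy
      _ = (volume (ball x r))⁻¹ * (∫⁻ y in ball x r, g y) +
            ((volume (ball x r))⁻¹ * volume (ball x r)) * ENNReal.ofReal (t / 2) := by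
          rw [lintegral_add_right _ measurable_const, setLIntegral_const]; ring
      _ ≤ _ := by
          rw [ENNReal.inv_mul_cancel hv hv', one_mul]
          gcongr
          exact le_iSup₂ (f := fun (r : ℝ) (_ : 0 < r) =>
            (volume (ball x r))⁻¹ * ∫⁻ y in ball x r, g y) r hr
  have hsub : {x | ENNReal.ofReal t < paperHLMax F x} ⊆
      {x | ENNReal.ofReal (t / 2) < paperHLMax g x} := by
    intro x hx
    have h1 : ENNReal.ofReal t < paperHLMax g x + ENNReal.ofReal (t / 2) :=
      lt_of_lt_of_le hx (hM x)
    change ENNReal.ofReal (t / 2) < paperHLMax g x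
    by_contra! hcon
    have h2 : paperHLMax g x + ENNReal.ofReal (t / 2) ≤ ENNReal.ofReal t := by
      calc _ ≤ ENNReal.ofReal (t / 2) + ENNReal.ofReal (t / 2) := by gcongr
        _ = _ := by rw [← ENNReal.ofReal_add (by positivity) (by positivity)]; congr 1; ring
    exact absurd h1 (not_lt.2 h2)
  have hpt : ∀ x, g x ≤ ∑' i : ℕ, ({x | ENNReal.ofReal (2 ^ i / 2 * t) < F x} : Set _).indicator
      (fun _ => ENNReal.ofReal (2 ^ i * t)) x := by
    intro x
    by_cases hx : x ∈ S
    · rw [hg, indicator_of_mem hx]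
      have hex : ∃ k : ℕ, F x ≤ ENNReal.ofReal (2 ^ k / 2 * t) := by
        obtain ⟨k, hk⟩ := pow_unbounded_of_one_lt ((F x).toReal * 2 / t) (one_lt_two (α := ℝ))
        refine ⟨k, ?_⟩
        rw [← ENNReal.ofReal_toReal (hFt x)]
        apply ENNReal.ofReal_le_ofReal
        rw [div_lt_iff₀ ht] at hk
        linarith
      have hk := Nat.find_spec hex
      have hk' := fun j => Nat.find_min hex (m := j)
      set k := Nat.find hex
      have hx' : ENNReal.ofReal (t / 2) < F x := hx
      obtain ⟨j, hj⟩ : ∃ j, k = j + 1 := by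
        apply Nat.exists_eq_succ_of_ne_zero
        intro h0
        rw [h0] at hk
        refine absurd hx' (not_lt.2 (hk.trans (le_of_eq ?_)))
        congr 1; ring
      have hjx := hk' j (by omega)
      push Not at hjx
      refine le_trans ?_ (ENNReal.le_tsum j)
      rw [indicator_of_mem (show x ∈ {x | ENNReal.ofReal (2 ^ j / 2 * t) < F x} from hjx)]
      rw [hj] at hk
      refine hk.trans (le_of_eq ?_)
      congr 1; rw [pow_succ]; ring
    · rw [hg, indicator_of_notMem hx]; exact zero_le
  have hnull : ∀ a : ℝ≥0∞, NullMeasurableSet {x | a < F x} := fun a =>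
    nullMeasurableSet_lt aemeasurable_const hF
  have hint : ∫⁻ y, g y ≤ ∑' i : ℕ, ENNReal.ofReal (2 ^ i * t) *
      volume {x | ENNReal.ofReal (2 ^ i / 2 * t) < F x} := by
    calc ∫⁻ y, g y ≤ _ := lintegral_mono hpt
      _ = _ := by
        rw [lintegral_tsum]
        · congr 1; ext i
          rw [lintegral_indicator_const₀ (hnull _)]
        · intro i
          exact aemeasurable_const.indicator₀ (hnull _)
  calc _ ≤ _ := measure_mono hsub
    _ ≤ _ := weakType hn g hgI (t / 2) (by positivity)
    _ ≤ ENNReal.ofReal (5 ^ n / (t / 2)) * (∑' i : ℕ, ENNReal.ofReal (2 ^ i * t) *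
      volume {x | ENNReal.ofReal (2 ^ i / 2 * t) < F x}) := by gcongr
    _ = _ := by
      rw [← ENNReal.tsum_mul_left, ← ENNReal.tsum_mul_left]
      congr 1; ext i
      rw [← mul_assoc, ← mul_assoc, ← ENNReal.ofReal_mul (by positivity),
        ← ENNReal.ofReal_mul (by positivity)]
      congr 2
      field_simp

lemma tsum_geo (x : ℝ) (h0 : 0 ≤ x) (h1 : x < 1) :
    ∑' i : ℕ, ENNReal.ofReal (x ^ i) = ENNReal.ofReal ((1 - x)⁻¹) := by
  rw [← ENNReal.ofReal_tsum_of_nonneg (fun i => by positivity)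
    (summable_geometric_of_lt_one h0 h1), tsum_geometric_of_lt_one h0 h1]

lemma sumPow (x y r : ℝ) (hx : 0 < x) (hx1 : x < 1) (hy : 0 < y) (hxy : x * y = 2) (hr : 0 < r)
    (a : ℕ → ℝ≥0∞) :
    (∑' i : ℕ, ENNReal.ofReal (2 ^ i) * a i) ^ r ≤
      ENNReal.ofReal ((1 - x)⁻¹ ^ r) * ∑' i : ℕ, ENNReal.ofReal ((y ^ r) ^ i) * a i ^ r := by
  set S := ∑' i : ℕ, ENNReal.ofReal ((y ^ r) ^ i) * a i ^ r with hS
  have hx2 : 0 < 1 - x := by linarith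
  have h1 : ∀ i, ENNReal.ofReal (2 ^ i) * a i ≤ ENNReal.ofReal (x ^ i) * S ^ (1 / r) := by
    intro i
    rw [← hxy, mul_pow, ENNReal.ofReal_mul (by positivity), mul_assoc]
    gcongr
    rw [one_div, ENNReal.le_rpow_inv_iff hr, ENNReal.mul_rpow_of_nonneg _ _ hr.le,
      ENNReal.ofReal_rpow_of_pos (by positivity)]
    refine le_trans (le_of_eq ?_) (ENNReal.le_tsum i)
    congr 2
    rw [← Real.rpow_natCast, ← Real.rpow_natCast, ← Real.rpow_mul hy.le, ← Real.rpow_mul hy.le,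
      mul_comm]
  calc _ ≤ (∑' i : ℕ, ENNReal.ofReal (x ^ i) * S ^ (1 / r)) ^ r := by
        exact ENNReal.rpow_le_rpow (ENNReal.tsum_le_tsum h1) hr.le
    _ = _ := by
      rw [ENNReal.tsum_mul_right, tsum_geo x hx.le hx1, ENNReal.mul_rpow_of_nonneg _ _ hr.le,
        ENNReal.ofReal_rpow_of_pos (by positivity), ← ENNReal.rpow_mul, one_div,
        inv_mul_cancel₀ hr.ne', ENNReal.rpow_one]

lemma maxLorentz {n : ℕ} (hn : 2 ≤ n) (m r : ℝ) (hm : 1 < m) (hr : 0 < r) :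
    ∃ K : ℝ, 0 < K ∧ ∀ (F : EuclideanSpace ℝ (Fin n) → ℝ≥0∞),
      AEMeasurable F → (∀ x, F x ≠ ⊤) → ∫⁻ y, F y ≠ ⊤ →
      ∫⁻ t in Ioi (0 : ℝ), ENNReal.ofReal (t ^ (r * m - 1)) *
          volume {x | ENNReal.ofReal t < paperHLMax F x} ^ r ≤
        ENNReal.ofReal K * ∫⁻ t in Ioi (0 : ℝ), ENNReal.ofReal (t ^ (r * m - 1)) *
          volume {x | ENNReal.ofReal t < F x} ^ r := by
  set ε := (m - 1) / 2 with hε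
  have hε0 : 0 < ε := by rw [hε]; linarith
  set x : ℝ := 2 ^ (-ε) with hx
  set y : ℝ := 2 ^ (1 + ε) with hy
  have hx0 : 0 < x := by positivity
  have hy0 : 0 < y := by positivity
  have hx1 : x < 1 := Real.rpow_lt_one_of_one_lt_of_neg (by norm_num) (by linarith)
  have hxy : x * y = 2 := by
    rw [hx, hy, ← Real.rpow_add (by norm_num)]; norm_num
  set b := r * m with hb
  set z : ℝ := y ^ r / 2 ^ b with hz
  have hz0 : 0 < z := by positivity
  have hz1 : z < 1 := by
    rw [hz, hy, ← Real.rpow_mul (by norm_num), ← Real.rpow_sub (by norm_num)]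
    apply Real.rpow_lt_one_of_one_lt_of_neg (by norm_num)
    rw [hb, hε]; nlinarith
  have hx2 : 0 < 1 - x := by linarith
  have hz2 : 0 < 1 - z := by linarith
  set K1 : ℝ := (2 * 5 ^ n) ^ r * (1 - x)⁻¹ ^ r with hK1
  have hK10 : 0 < K1 := by positivity
  refine ⟨K1 * (2 ^ b * (1 - z)⁻¹), by positivity, ?_⟩
  intro F hF hFt hI
  set I := ∫⁻ t in Ioi (0 : ℝ), ENNReal.ofReal (t ^ (b - 1)) *
          volume {x | ENNReal.ofReal t < F x} ^ r with hIdef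
  have hterm : ∀ i : ℕ, ∫⁻ t in Ioi (0 : ℝ), ENNReal.ofReal (t ^ (b - 1)) *
      volume {x | ENNReal.ofReal (2 ^ i / 2 * t) < F x} ^ r =
        ENNReal.ofReal (2 ^ b * (1 / 2 ^ b) ^ i) * I := by
    intro i
    have h := substIoi (2 ^ i / 2) 1 b (by positivity) one_pos
      (fun t => volume {x | ENNReal.ofReal t < F x} ^ r)
    simp only [Real.rpow_one, one_mul, mul_one] at h
    rw [hIdef, h, ← mul_assoc, ← ENNReal.ofReal_mul (by positivity)]
    have : (2:ℝ) ^ b * (1 / 2 ^ b) ^ i * (2 ^ i / 2) ^ b = 1 := by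
      rw [Real.div_rpow (by positivity) (by norm_num), ← Real.rpow_natCast 2 i,
        ← Real.rpow_mul (by norm_num), mul_comm (i : ℝ) b, Real.rpow_mul (by norm_num) b (i : ℝ),
        Real.rpow_natCast, one_div, inv_pow]
      field_simp
    rw [this, ENNReal.ofReal_one, one_mul]
  have hmeas : ∀ i : ℕ, Measurable (fun t : ℝ => ENNReal.ofReal (t ^ (b - 1)) *
      volume {x | ENNReal.ofReal (2 ^ i / 2 * t) < F x} ^ r) := by
    intro i
    have : Antitone (fun t : ℝ => volume {x | ENNReal.ofReal (2 ^ i / 2 * t) < F x}) := by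
      intro t t' h
      refine measure_mono ?_
      intro x hx
      refine lt_of_le_of_lt (ENNReal.ofReal_le_ofReal ?_) hx
      gcongr
    have h1 : Measurable (fun t : ℝ => ENNReal.ofReal (t ^ (b - 1))) := by fun_prop
    exact h1.mul (this.measurable.pow_const r)
  calc ∫⁻ t in Ioi (0 : ℝ), ENNReal.ofReal (t ^ (b - 1)) *
          volume {x | ENNReal.ofReal t < paperHLMax F x} ^ r
      ≤ ∫⁻ t in Ioi (0 : ℝ), ENNReal.ofReal K1 * ∑' i : ℕ, ENNReal.ofReal ((y ^ r) ^ i) *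
          (ENNReal.ofReal (t ^ (b - 1)) *
            volume {x | ENNReal.ofReal (2 ^ i / 2 * t) < F x} ^ r) := by
        refine setLIntegral_mono' measurableSet_Ioi ?_
        intro t ht
        calc ENNReal.ofReal (t ^ (b - 1)) * volume {x | ENNReal.ofReal t < paperHLMax F x} ^ r
            ≤ ENNReal.ofReal (t ^ (b - 1)) * (ENNReal.ofReal (2 * 5 ^ n) *
              ∑' i : ℕ, ENNReal.ofReal (2 ^ i) *
                volume {x | ENNReal.ofReal (2 ^ i / 2 * t) < F x}) ^ r := by
              gcongr; exact levelBound hn F hF hFt hI t ht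
          _ ≤ ENNReal.ofReal (t ^ (b - 1)) * (ENNReal.ofReal ((2 * 5 ^ n) ^ r) *
              (ENNReal.ofReal ((1 - x)⁻¹ ^ r) * ∑' i : ℕ, ENNReal.ofReal ((y ^ r) ^ i) *
                volume {x | ENNReal.ofReal (2 ^ i / 2 * t) < F x} ^ r)) := by
              rw [ENNReal.mul_rpow_of_nonneg _ _ hr.le, ENNReal.ofReal_rpow_of_pos (by positivity)]
              gcongr
              exact sumPow x y r hx0 hx1 hy0 hxy hr _
          _ = ENNReal.ofReal K1 * (ENNReal.ofReal (t ^ (b - 1)) *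
              ∑' i : ℕ, ENNReal.ofReal ((y ^ r) ^ i) *
                volume {x | ENNReal.ofReal (2 ^ i / 2 * t) < F x} ^ r) := by
              rw [hK1, ENNReal.ofReal_mul (by positivity)]; ring
          _ = _ := by
              rw [← ENNReal.tsum_mul_left]
              congr 2; ext i; ring
    _ = ENNReal.ofReal K1 * ∑' i : ℕ, ENNReal.ofReal ((y ^ r) ^ i) *
          (ENNReal.ofReal (2 ^ b * (1 / 2 ^ b) ^ i) * I) := by
        rw [lintegral_const_mul' _ _ ENNReal.ofReal_ne_top, lintegral_tsum]
        · congr 2; ext i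
          rw [lintegral_const_mul' _ _ ENNReal.ofReal_ne_top, hterm]
        · intro i
          exact ((hmeas i).const_mul _).aemeasurable
    _ = ENNReal.ofReal K1 * ∑' i : ℕ, ENNReal.ofReal (z ^ i) * (ENNReal.ofReal (2 ^ b) * I) := by
        congr 2; ext i
        rw [← mul_assoc, ← mul_assoc, ← ENNReal.ofReal_mul (by positivity),
          ← ENNReal.ofReal_mul (by positivity)]
        congr 2
        rw [hz, div_pow, div_pow]; simp; ring
    _ = _ := by
        rw [ENNReal.tsum_mul_right, tsum_geo z hz0.le hz1, ENNReal.ofReal_mul hK10.le,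
          ENNReal.ofReal_mul (p := 2 ^ b) (by positivity)]
        ring

lemma finSumPow {ι : Type*} (T : Finset ι) (v : ι → ℝ≥0∞) (r : ℝ) (hr : 0 < r) :
    (∑ c ∈ T, v c) ^ r ≤ (T.card : ℝ≥0∞) ^ r * ∑ c ∈ T, v c ^ r := by
  set S := ∑ c ∈ T, v c ^ r with hS
  have h1 : ∀ c ∈ T, v c ≤ S ^ (1 / r) := by
    intro c hc
    rw [one_div, ENNReal.le_rpow_inv_iff hr]
    exact Finset.single_le_sum (f := fun c => v c ^ r) (fun _ _ => zero_le) hc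
  calc _ ≤ ((T.card : ℝ≥0∞) * S ^ (1 / r)) ^ r := by
        refine ENNReal.rpow_le_rpow ?_ hr.le
        refine (Finset.sum_le_sum h1).trans (le_of_eq ?_)
        rw [Finset.sum_const, nsmul_eq_mul]
    _ = _ := by
      rw [ENNReal.mul_rpow_of_nonneg _ _ hr.le, ← ENNReal.rpow_mul, one_div,
        inv_mul_cancel₀ hr.ne', ENNReal.rpow_one]

lemma coverLorentz (n : ℕ) (b r : ℝ) (hr : 0 < r) :
    ∃ K : ℝ, 0 < K ∧ ∀ (Ω : Set (EuclideanSpace ℝ (Fin n)))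
      (F : EuclideanSpace ℝ (Fin n) → ℝ≥0∞) (x₀ : EuclideanSpace ℝ (Fin n)) (ρ : ℝ) (J : ℝ≥0∞),
      0 < ρ → (∀ x ∉ Ω, F x = 0) →
      (∀ x' ∈ Ω, ∫⁻ t in Ioi (0 : ℝ), ENNReal.ofReal (t ^ (b - 1)) *
          volume {x ∈ ball x' ρ ∩ Ω | ENNReal.ofReal t < F x} ^ r ≤ J) →
      ∫⁻ t in Ioi (0 : ℝ), ENNReal.ofReal (t ^ (b - 1)) *
          volume {x ∈ ball x₀ (10 * ρ) | ENNReal.ofReal t < F x} ^ r ≤ ENNReal.ofReal K * J := by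
  classical
  obtain ⟨T₀, -, hTfin, hTcov⟩ :=
    (isCompact_closedBall (0 : EuclideanSpace ℝ (Fin n)) 10).finite_cover_balls
      (e := 1 / 2) (by norm_num)
  set T := hTfin.toFinset with hT
  refine ⟨(T.card : ℝ) ^ r * T.card + 1, by positivity, ?_⟩
  intro Ω F x₀ ρ J hρ hF0 hJ
  set T' := T.filter (fun c => (ball (x₀ + ρ • c) (ρ / 2) ∩ Ω).Nonempty) with hT'
  have hex : ∀ c ∈ T', ∃ z, z ∈ ball (x₀ + ρ • c) (ρ / 2) ∩ Ω := by
    intro c hc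
    exact (Finset.mem_filter.1 hc).2
  choose! X hX using hex
  have hsub : ∀ t : ℝ, {x ∈ ball x₀ (10 * ρ) | ENNReal.ofReal t < F x} ⊆
      ⋃ c ∈ T', {x ∈ ball (X c) ρ ∩ Ω | ENNReal.ofReal t < F x} := by
    rintro t x ⟨hxB, hxt⟩
    have hxΩ : x ∈ Ω := by
      by_contra hcon
      rw [hF0 x hcon] at hxt
      exact absurd hxt (by simp)
    have hy : ρ⁻¹ • (x - x₀) ∈ closedBall (0 : EuclideanSpace ℝ (Fin n)) 10 := by
      rw [mem_closedBall_zero_iff, norm_smul, norm_inv, Real.norm_of_nonneg hρ.le,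
        inv_mul_le_iff₀ hρ]
      rw [mem_ball, dist_eq_norm] at hxB
      linarith
    obtain ⟨c, hc, hyc⟩ := mem_iUnion₂.1 (hTcov hy)
    have hxc : x ∈ ball (x₀ + ρ • c) (ρ / 2) := by
      rw [mem_ball, dist_eq_norm] at hyc ⊢
      have e : x - (x₀ + ρ • c) = ρ • (ρ⁻¹ • (x - x₀) - c) := by
        rw [smul_sub, smul_smul, mul_inv_cancel₀ hρ.ne', one_smul]; abel
      rw [e, norm_smul, Real.norm_of_nonneg hρ.le]
      nlinarith
    have hcT : c ∈ T' := Finset.mem_filter.2 ⟨hTfin.mem_toFinset.2 hc, ⟨x, hxc, hxΩ⟩⟩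
    refine mem_iUnion₂.2 ⟨c, hcT, ⟨?_, hxΩ⟩, hxt⟩
    have h1 := (hX c hcT).1
    rw [mem_ball] at *
    have := dist_triangle_right x (X c) (x₀ + ρ • c)
    linarith
  calc _ ≤ ∫⁻ t in Ioi (0 : ℝ), (T'.card : ℝ≥0∞) ^ r * ∑ c ∈ T', ENNReal.ofReal (t ^ (b - 1)) *
          volume {x ∈ ball (X c) ρ ∩ Ω | ENNReal.ofReal t < F x} ^ r := by
        refine lintegral_mono fun t => ?_
        calc _ ≤ ENNReal.ofReal (t ^ (b - 1)) * ((T'.card : ℝ≥0∞) ^ r * ∑ c ∈ T',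
              volume {x ∈ ball (X c) ρ ∩ Ω | ENNReal.ofReal t < F x} ^ r) := by
              gcongr
              refine le_trans (ENNReal.rpow_le_rpow ?_ hr.le) (finSumPow T' _ r hr)
              exact (measure_mono (hsub t)).trans (measure_biUnion_finset_le _ _)
          _ = _ := by rw [← Finset.mul_sum]; ring
    _ = (T'.card : ℝ≥0∞) ^ r * ∑ c ∈ T', ∫⁻ t in Ioi (0 : ℝ), ENNReal.ofReal (t ^ (b - 1)) *
          volume {x ∈ ball (X c) ρ ∩ Ω | ENNReal.ofReal t < F x} ^ r := by
        rw [lintegral_const_mul' _ _ (ENNReal.rpow_ne_top_of_nonneg hr.le (by simp)),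
          lintegral_finsetSum]
        intro c _
        exact lint_meas b r volume _ F
    _ ≤ (T'.card : ℝ≥0∞) ^ r * ∑ c ∈ T', J := by
        gcongr with c hc
        exact hJ _ (hX c hc).2
    _ = (T'.card : ℝ≥0∞) ^ r * T'.card * J := by
        rw [Finset.sum_const, nsmul_eq_mul, mul_assoc]
    _ ≤ (T.card : ℝ≥0∞) ^ r * T.card * J := by
        have : (T'.card : ℝ≥0∞) ≤ T.card := by exact_mod_cast Finset.card_filter_le _ _
        gcongr
    _ ≤ _ := by
        gcongr
        rw [ENNReal.ofReal_add (by positivity) (by norm_num), ENNReal.ofReal_mul (by positivity),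
          ← ENNReal.ofReal_rpow_of_nonneg (by positivity) hr.le, ENNReal.ofReal_natCast]
        exact le_self_add

lemma coreIneq (n : ℕ) (hn : 2 ≤ n) (a b θ C₀ : ℝ) (ha : 0 < a) (hb : 0 < b) (hθ : 1 < θ)
    (hC₀ : 0 < C₀) (hm : 1 < a * ((θ - 1) / θ)) :
    ∃ C : ℝ, 0 < C ∧
      ∀ (Ω : Set (EuclideanSpace ℝ (Fin n)))
        (f : EuclideanSpace ℝ (Fin n) → ℝ)
        (x₀ : EuclideanSpace ℝ (Fin n)) (ρ : ℝ),
        Integrable f → (∀ x ∉ Ω, f x = 0) →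
        0 < ρ → ρ < Metric.diam Ω →
        (∀ x ∈ ball x₀ (10 * ρ),
          paperFracMax1
              ((ball x₀ (10 * ρ)).indicator fun y => ENNReal.ofReal (f y)) x ≤
            ENNReal.ofReal C₀ *
              (paperHLMax
                  ((ball x₀ (10 * ρ)).indicator fun y => ENNReal.ofReal (f y)) x) ^
                ((θ - 1) / θ) *
              (paperLorentzMorrey (a * ((θ - 1) / θ))
                  (b * ((θ - 1) / θ)) (a * (θ - 1))
                  (Metric.diam Ω) Ω fun y => ENNReal.ofReal (f y)) ^ (1 / θ)) →
        ENNReal.ofReal (ρ ^ (-(n : ℝ) / a + θ - 1)) *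
            paperLorentzNorm a b (ball x₀ ρ)
              (paperFracMax1
                ((ball x₀ (10 * ρ)).indicator fun y => ENNReal.ofReal (f y))) ≤
          ENNReal.ofReal C *
            paperLorentzMorrey (a * ((θ - 1) / θ))
                  (b * ((θ - 1) / θ)) (a * (θ - 1))
              (Metric.diam Ω) Ω (fun y => ENNReal.ofReal (f y)) := by
  set σ := (θ - 1) / θ with hσ
  have hθ1 : 0 < θ - 1 := by linarith
  have hθ0 : 0 < θ := by linarith
  have hσ0 : 0 < σ := by positivity
  set r := b / a with hr
  have hr0 : 0 < r := by positivity
  set m := a * σ with hmdef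
  set b' := b * σ with hb'
  have hm0 : 0 < m := by positivity
  have hb'0 : 0 < b' := by positivity
  set κ := a * (θ - 1) with hκ
  have hrm : r * m = b' := by rw [hr, hmdef, hb']; field_simp
  have hb'm : b' / m = r := by rw [← hrm]; field_simp
  obtain ⟨K1, hK1, hmax⟩ := maxLorentz hn m r hm hr0
  obtain ⟨K2, hK2, hcov⟩ := coverLorentz n b' r hr0
  rw [hrm] at hmax
  refine ⟨C₀ * (K1 * K2) ^ (1 / b), by positivity, ?_⟩
  intro Ω f x₀ ρ hf hf0 hρ hρT hH
  set F₀ : EuclideanSpace ℝ (Fin n) → ℝ≥0∞ := fun y => ENNReal.ofReal (f y) with hF₀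
  set F := (ball x₀ (10 * ρ)).indicator F₀ with hF
  set N := paperLorentzMorrey m b' κ (Metric.diam Ω) Ω F₀ with hN
  have hsubB : ball x₀ ρ ⊆ ball x₀ (10 * ρ) := ball_subset_ball (by linarith)
  have hCpos : 0 < C₀ * (K1 * K2) ^ (1 / b) := by positivity
  by_cases hNt : N = ⊤
  · rw [hNt, ENNReal.mul_top (by simpa using hCpos)]; exact le_top
  by_cases hN0 : N = 0
  · -- trivial case
    have h0 : paperLorentzNorm a b (ball x₀ ρ) (paperFracMax1 F) = 0 := by
      unfold paperLorentzNorm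
      have : ∀ t : ℝ, volume {x ∈ ball x₀ ρ | ENNReal.ofReal t < paperFracMax1 F x} = 0 := by
        intro t
        have he : {x ∈ ball x₀ ρ | ENNReal.ofReal t < paperFracMax1 F x} = ∅ := by
          rw [Set.eq_empty_iff_forall_notMem]
          rintro x ⟨hx, hx'⟩
          have h1 := hH x (hsubB hx)
          rw [hN0, ENNReal.zero_rpow_of_pos (by positivity), mul_zero] at h1
          exact absurd (lt_of_lt_of_le hx' h1) (by simp)
        rw [he, measure_empty]
      simp only [this]
      rw [ENNReal.zero_rpow_of_pos hr0]
      simp [hb]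
    rw [h0, mul_zero]; exact zero_le
  obtain ⟨ν, hν, hNν⟩ : ∃ ν : ℝ, 0 < ν ∧ N = ENNReal.ofReal ν :=
    ⟨N.toReal, ENNReal.toReal_pos hN0 hNt, (ENNReal.ofReal_toReal hNt).symm⟩
  -- the Morrey bound at scale ρ
  set Y := (ρ ^ (-((κ - n) / m)) * ν) with hY
  have hY0 : 0 < Y := by positivity
  have hJ : ∀ x' ∈ Ω, ∫⁻ t in Ioi (0 : ℝ), ENNReal.ofReal (t ^ (b' - 1)) *
          volume {x ∈ ball x' ρ ∩ Ω | ENNReal.ofReal t < F₀ x} ^ r ≤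
        ENNReal.ofReal (Y ^ b' / m) := by
    intro x' hx'
    have h1 : ENNReal.ofReal (ρ ^ ((κ - n) / m)) * paperLorentzNorm m b' (ball x' ρ ∩ Ω) F₀ ≤ N := by
      rw [hN]
      unfold paperLorentzMorrey
      exact le_iSup_of_le x' (le_iSup_of_le hx' (le_iSup_of_le ρ (le_iSup_of_le hρ
        (le_iSup_of_le hρT le_rfl))))
    unfold paperLorentzNorm at h1
    rw [hb'm] at h1
    set I := ∫⁻ t in Ioi (0 : ℝ), ENNReal.ofReal (t ^ (b' - 1)) *
          volume {x ∈ ball x' ρ ∩ Ω | ENNReal.ofReal t < F₀ x} ^ r with hI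
    have h2 : (ENNReal.ofReal m * I) ^ (1 / b') ≤ ENNReal.ofReal Y := by
      calc (ENNReal.ofReal m * I) ^ (1 / b')
          = ENNReal.ofReal (ρ ^ (-((κ - n) / m))) *
            (ENNReal.ofReal (ρ ^ ((κ - n) / m)) * (ENNReal.ofReal m * I) ^ (1 / b')) := by
            rw [← mul_assoc, ← ENNReal.ofReal_mul (by positivity), ← Real.rpow_add hρ]
            simp
        _ ≤ ENNReal.ofReal (ρ ^ (-((κ - n) / m))) * N := by gcongr
        _ = _ := by rw [hNν, ← ENNReal.ofReal_mul (by positivity)]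
    rw [one_div, ENNReal.rpow_inv_le_iff hb'0, ENNReal.ofReal_rpow_of_pos hY0] at h2
    calc I = ENNReal.ofReal (1 / m) * (ENNReal.ofReal m * I) := by
          rw [← mul_assoc, ← ENNReal.ofReal_mul (by positivity), one_div,
            inv_mul_cancel₀ hm0.ne', ENNReal.ofReal_one, one_mul]
      _ ≤ ENNReal.ofReal (1 / m) * ENNReal.ofReal (Y ^ b') := by gcongr
      _ = _ := by rw [← ENNReal.ofReal_mul (by positivity)]; congr 1; ring
  have hcov' := hcov Ω F₀ x₀ ρ _ hρ (fun x hx => by simp [hF₀, hf0 x hx]) hJ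
  have hF₀m : AEMeasurable F₀ := hf.1.aemeasurable.ennreal_ofReal
  have hF₀I : ∫⁻ y, F₀ y ≠ ⊤ := by
    have h1 := hf.2
    rw [hasFiniteIntegral_iff_norm] at h1
    refine ne_top_of_le_ne_top h1.ne (lintegral_mono fun y => ?_)
    exact ENNReal.ofReal_le_ofReal (Real.le_norm_self _)
  have hFle : ∀ x, F x ≤ F₀ x := fun x => indicator_le_self _ _ x
  have hmax' := hmax F (hF₀m.indicator measurableSet_ball)
    (fun x => ne_top_of_le_ne_top ENNReal.ofReal_ne_top (hFle x))
    (ne_top_of_le_ne_top hF₀I (lintegral_mono hFle))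
  have hlev : ∀ t : ℝ, {x | ENNReal.ofReal t < F x} ⊆
      {x ∈ ball x₀ (10 * ρ) | ENNReal.ofReal t < F₀ x} := by
    intro t x hx
    have hx : ENNReal.ofReal t < F x := hx
    refine ⟨?_, lt_of_lt_of_le hx (hFle x)⟩
    by_contra hcon
    rw [hF, indicator_of_notMem hcon] at hx
    exact absurd hx (by simp)
  have hMF : ∫⁻ t in Ioi (0 : ℝ), ENNReal.ofReal (t ^ (b' - 1)) *
          volume {x | ENNReal.ofReal t < paperHLMax F x} ^ r ≤
        ENNReal.ofReal (K1 * (K2 * (Y ^ b' / m))) := by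
    rw [ENNReal.ofReal_mul hK1.le, ENNReal.ofReal_mul hK2.le]
    refine hmax'.trans ?_
    gcongr
    refine le_trans (lintegral_mono fun t => ?_) hcov'
    gcongr
    exact fun hx => hlev t hx
  -- pass from the Hardy-Littlewood to the fractional maximal function
  set A := C₀ * ν ^ (1 / θ) with hA
  have hA0 : 0 < A := by positivity
  set c := A ^ (-(1 / σ)) with hc
  have hc0 : 0 < c := by positivity
  have hincl : ∀ t : ℝ, 0 < t → {x ∈ ball x₀ ρ | ENNReal.ofReal t < paperFracMax1 F x} ⊆
      {x | ENNReal.ofReal (c * t ^ (1 / σ)) < paperHLMax F x} := by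
    rintro t ht x ⟨hx, hxt⟩
    change ENNReal.ofReal (c * t ^ (1 / σ)) < paperHLMax F x
    have h1 := hH x (hsubB hx)
    by_contra! hcon
    have h2 : paperFracMax1 F x ≤ ENNReal.ofReal t := by
      refine h1.trans ?_
      calc ENNReal.ofReal C₀ * paperHLMax F x ^ σ * N ^ (1 / θ)
          ≤ ENNReal.ofReal C₀ * ENNReal.ofReal (c * t ^ (1 / σ)) ^ σ * N ^ (1 / θ) := by gcongr
        _ = ENNReal.ofReal (C₀ * (c * t ^ (1 / σ)) ^ σ * ν ^ (1 / θ)) := by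
          rw [hNν, ENNReal.ofReal_rpow_of_pos (by positivity), ENNReal.ofReal_rpow_of_pos hν,
            ← ENNReal.ofReal_mul (by positivity), ← ENNReal.ofReal_mul (by positivity)]
        _ = ENNReal.ofReal t := by
          congr 1
          rw [Real.mul_rpow hc0.le (by positivity), ← Real.rpow_mul ht.le, hc,
            ← Real.rpow_mul hA0.le, one_div, neg_mul, inv_mul_cancel₀ hσ0.ne', Real.rpow_one,
            Real.rpow_neg_one, hA]
          field_simp
    exact absurd hxt (not_lt.2 h2)
  have hsub := substIoi c (1 / σ) b' hc0 (by positivity)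
    (fun u => volume {x | ENNReal.ofReal u < paperHLMax F x} ^ r)
  have hexp : 1 / σ * b' = b := by rw [hb']; field_simp
  rw [hexp] at hsub
  have hcb : c ^ b' = A ^ (-b) := by
    rw [hc, ← Real.rpow_mul hA0.le]; congr 1; rw [hb']; field_simp
  have hI1 : ∫⁻ t in Ioi (0 : ℝ), ENNReal.ofReal (t ^ (b - 1)) *
          volume {x ∈ ball x₀ ρ | ENNReal.ofReal t < paperFracMax1 F x} ^ r ≤
        ENNReal.ofReal (A ^ b * σ * (K1 * (K2 * (Y ^ b' / m)))) := by
    calc _ ≤ ∫⁻ t in Ioi (0 : ℝ), ENNReal.ofReal (t ^ (b - 1)) *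
          volume {x | ENNReal.ofReal (c * t ^ (1 / σ)) < paperHLMax F x} ^ r := by
          refine setLIntegral_mono' measurableSet_Ioi fun t ht => ?_
          gcongr
          exact fun hx => hincl t ht hx
      _ = ENNReal.ofReal (A ^ b * σ) * ∫⁻ t in Ioi (0 : ℝ), ENNReal.ofReal (t ^ (b' - 1)) *
          volume {x | ENNReal.ofReal t < paperHLMax F x} ^ r := by
          rw [hsub, ← mul_assoc, ← ENNReal.ofReal_mul (by positivity)]
          have : A ^ b * σ * (c ^ b' * (1 / σ)) = 1 := by
            rw [hcb, Real.rpow_neg hA0.le]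
            field_simp
          rw [this, ENNReal.ofReal_one, one_mul]
      _ ≤ _ := by
          rw [ENNReal.ofReal_mul (p := A ^ b * σ) (by positivity)]
          gcongr
  calc ENNReal.ofReal (ρ ^ (-(n : ℝ) / a + θ - 1)) *
            paperLorentzNorm a b (ball x₀ ρ) (paperFracMax1 F)
      ≤ ENNReal.ofReal (ρ ^ (-(n : ℝ) / a + θ - 1)) *
          (ENNReal.ofReal a * ENNReal.ofReal (A ^ b * σ * (K1 * (K2 * (Y ^ b' / m))))) ^ (1 / b) := by
        unfold paperLorentzNorm
        gcongr
    _ = ENNReal.ofReal (ρ ^ (-(n : ℝ) / a + θ - 1) *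
          (a * (A ^ b * σ * (K1 * (K2 * (Y ^ b' / m))))) ^ (1 / b)) := by
        rw [← ENNReal.ofReal_mul ha.le, ENNReal.ofReal_rpow_of_pos (by positivity),
          ← ENNReal.ofReal_mul (by positivity)]
    _ = ENNReal.ofReal (C₀ * (K1 * K2) ^ (1 / b) * ν) := by
        congr 1
        have e1 : a * (A ^ b * σ * (K1 * (K2 * (Y ^ b' / m)))) = A ^ b * (K1 * K2) * Y ^ b' := by
          rw [hmdef]; field_simp
        have e2 : (A ^ b) ^ (1 / b) = A := by
          rw [← Real.rpow_mul hA0.le, mul_one_div_cancel hb.ne', Real.rpow_one]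
        have e3 : (Y ^ b') ^ (1 / b) = ρ ^ (-((κ - n) / a)) * ν ^ σ := by
          rw [← Real.rpow_mul hY0.le, hY, Real.mul_rpow (by positivity) hν.le,
            ← Real.rpow_mul hρ.le]
          have : b' * (1 / b) = σ := by rw [hb']; field_simp
          rw [this]
          congr 2
          rw [hmdef]; field_simp
        have e4 : ρ ^ (-(n : ℝ) / a + θ - 1) * ρ ^ (-((κ - n) / a)) = 1 := by
          rw [← Real.rpow_add hρ]
          have : -(n : ℝ) / a + θ - 1 + -((κ - n) / a) = 0 := by
            rw [hκ]; field_simp; ring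
          rw [this, Real.rpow_zero]
        have e5 : ν ^ (1 / θ) * ν ^ σ = ν := by
          rw [← Real.rpow_add hν]
          have : 1 / θ + σ = 1 := by rw [hσ]; field_simp; ring
          rw [this, Real.rpow_one]
        rw [e1, Real.mul_rpow (by positivity) (by positivity),
          Real.mul_rpow (by positivity) (by positivity), e2, e3, hA]
        calc _ = C₀ * (K1 * K2) ^ (1 / b) * (ν ^ (1 / θ) * ν ^ σ) *
              (ρ ^ (-(n : ℝ) / a + θ - 1) * ρ ^ (-((κ - n) / a))) := by ring
          _ = _ := by rw [e4, e5, mul_one]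
    _ = _ := by rw [ENNReal.ofReal_mul hCpos.le, hNν]

/-- From the Hedberg-type pointwise estimate
`𝐌₁(χ_B f) ≤ C₀ [𝐌(χ_B f)]^{(θ-1)/θ} N^{1/θ}` on `B = B_{10ρ}(x₀)` one deduces
`ρ^{-n(p-1)/q+θ-1} ‖𝐌₁(χ_B f)‖_{L^{q/(p-1), s/(p-1)}(B_ρ(x₀))} ≤ C N`, where
`N` is the Lorentz–Morrey norm `‖f‖_{L^{m, s(θ-1)/(θ(p-1)); κ}(Ω)}` with
`m = q(θ-1)/(θ(p-1)) > 1`, `κ = q(θ-1)/(p-1) ∈ (0, n]`, and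
`C = C(n,p,q,s,θ,C₀)`. -/
theorem stmt7 (n : ℕ) (hn : 2 ≤ n) (p q s θ C₀ : ℝ)
    (hp : 1 < p) (hq : 0 < q) (hs : 0 < s) (hθ : 1 < θ) (hC₀ : 0 < C₀)
    (hm : 1 < q * (θ - 1) / (θ * (p - 1)))
    (hκ0 : 0 < q * (θ - 1) / (p - 1)) (hκn : q * (θ - 1) / (p - 1) ≤ n) :
    ∃ C : ℝ, 0 < C ∧
      ∀ (Ω : Set (EuclideanSpace ℝ (Fin n)))
        (f : EuclideanSpace ℝ (Fin n) → ℝ)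
        (x₀ : EuclideanSpace ℝ (Fin n)) (ρ : ℝ),
        Bornology.IsBounded Ω → 0 < Metric.diam Ω →
        (∀ x, 0 ≤ f x) → Integrable f → (∀ x ∉ Ω, f x = 0) →
        0 < ρ → ρ < Metric.diam Ω →
        (∀ x ∈ ball x₀ (10 * ρ),
          paperFracMax1
              ((ball x₀ (10 * ρ)).indicator fun y => ENNReal.ofReal (f y)) x ≤
            ENNReal.ofReal C₀ *
              (paperHLMax
                  ((ball x₀ (10 * ρ)).indicator fun y => ENNReal.ofReal (f y)) x) ^
                ((θ - 1) / θ) *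
              (paperLorentzMorrey (q * (θ - 1) / (θ * (p - 1)))
                  (s * (θ - 1) / (θ * (p - 1))) (q * (θ - 1) / (p - 1))
                  (Metric.diam Ω) Ω fun y => ENNReal.ofReal (f y)) ^ (1 / θ)) →
        ENNReal.ofReal (ρ ^ (-(n : ℝ) * (p - 1) / q + θ - 1)) *
            paperLorentzNorm (q / (p - 1)) (s / (p - 1)) (ball x₀ ρ)
              (paperFracMax1
                ((ball x₀ (10 * ρ)).indicator fun y => ENNReal.ofReal (f y))) ≤
          ENNReal.ofReal C *
            paperLorentzMorrey (q * (θ - 1) / (θ * (p - 1)))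
              (s * (θ - 1) / (θ * (p - 1))) (q * (θ - 1) / (p - 1))
              (Metric.diam Ω) Ω (fun y => ENNReal.ofReal (f y)) := by
  have hp1 : 0 < p - 1 := by linarith
  have hθ0 : 0 < θ := by linarith
  have e1 : q * (θ - 1) / (θ * (p - 1)) = q / (p - 1) * ((θ - 1) / θ) := by field_simp
  have e2 : s * (θ - 1) / (θ * (p - 1)) = s / (p - 1) * ((θ - 1) / θ) := by field_simp
  have e3 : q * (θ - 1) / (p - 1) = q / (p - 1) * (θ - 1) := by field_simp
  have e4 : -(n : ℝ) * (p - 1) / q = -(n : ℝ) / (q / (p - 1)) := by field_simp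
  rw [e1] at hm
  obtain ⟨C, hC, h⟩ := coreIneq n hn (q / (p - 1)) (s / (p - 1)) θ C₀ (by positivity)
    (by positivity) hθ hC₀ hm
  refine ⟨C, hC, ?_⟩
  intro Ω f x₀ ρ _ _ _ hf hf0 hρ hρT hH
  rw [e1, e2, e3] at hH ⊢
  rw [e4]
  exact h Ω f x₀ ρ hf hf0 hρ hρT hH
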